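/- arXiv:1907.02525 — 7 statements merged into one kernel-verified Lean document; each statement's English description precedes it below -/
import Mathlib

section
/- Let σ: Γ × X → H be a measurable cocycle and let ψ: H^{n+1} → ℝ be a bounded measurable H-invariant function. Then the pullback cochain Cⁿ(σ)(ψ) is Γ-invariant, i.e. for all γ, γ₀, …, γₙ ∈ Γ one has Cⁿ(σ)(ψ)(γ·γ₀, …, γ·γₙ) = Cⁿ(σ)(ψ)(γ₀, …, γₙ). -/
open MeasureTheory

/-- Let `σ : Γ × X → H` be a measurable cocycle and `ψ : H^{n+1} → ℝ` a
bounded measurable `H`-invariant function.  Then the pullback cochain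
`Cⁿ(σ)(ψ)(γ₀, …, γₙ) = ∫_X ψ(σ(γ₀⁻¹,x)⁻¹, …, σ(γₙ⁻¹,x)⁻¹) dμ(x)` is `Γ`-invariant. -/
theorem pullback_cochain_invariant
    {Γ H X : Type*} [Group Γ] [Group H]
    [MeasurableSpace Γ] [MeasurableSpace H] [MeasurableSpace X]
    [MeasurableMul₂ Γ] [MeasurableInv Γ] [MeasurableMul₂ H] [MeasurableInv H]
    [MulAction Γ X]
    (hactmeas : Measurable fun p : Γ × X => p.1 • p.2)
    (μ : Measure X) [IsProbabilityMeasure μ]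
    (hμ : ∀ γ : Γ, MeasurePreserving (fun x : X => γ • x) μ μ)
    (σ : Γ → X → H) (hσmeas : Measurable fun p : Γ × X => σ p.1 p.2)
    (hσ : ∀ γ₁ γ₂ : Γ, ∀ᵐ x ∂μ, σ (γ₁ * γ₂) x = σ γ₁ (γ₂ • x) * σ γ₂ x)
    {n : ℕ} (ψ : (Fin (n + 1) → H) → ℝ)
    (hψmeas : Measurable ψ) (hψbdd : ∃ C : ℝ, ∀ v, |ψ v| ≤ C)
    (hψinv : ∀ (h : H) (v : Fin (n + 1) → H), ψ (fun i => h * v i) = ψ v) :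
    ∀ (γ : Γ) (γs : Fin (n + 1) → Γ),
      (∫ x, ψ (fun i => (σ (γ * γs i)⁻¹ x)⁻¹) ∂μ)
        = ∫ x, ψ (fun i => (σ (γs i)⁻¹ x)⁻¹) ∂μ := by
  intro γ γs
  have hmeas : Measurable fun x => ψ (fun i => (σ (γs i)⁻¹ x)⁻¹) :=
    hψmeas.comp (measurable_pi_lambda _ fun i =>
      (hσmeas.comp (measurable_const.prodMk measurable_id)).inv)
  calc ∫ x, ψ (fun i => (σ (γ * γs i)⁻¹ x)⁻¹) ∂μ
      = ∫ x, ψ (fun i => (σ (γs i)⁻¹ (γ⁻¹ • x))⁻¹) ∂μ := by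
        refine integral_congr_ae ?_
        filter_upwards [ae_all_iff.2 fun i => hσ (γs i)⁻¹ γ⁻¹] with x hx
        simp only [mul_inv_rev, hx, hψinv]
    _ = ∫ x, ψ (fun i => (σ (γs i)⁻¹ x)⁻¹) ∂μ := by
        rw [← integral_map (hμ γ⁻¹).aemeasurable hmeas.aestronglyMeasurable, (hμ γ⁻¹).map_eq]
end

section
/- Let σ: Γ × X → H be a measurable cocycle. The pullback is a cochain map: for every n ≥ 0 and every bounded measurable function ψ: H^{n+1} → ℝ one has C^{n+1}(σ)(δⁿψ) = δⁿ(Cⁿ(σ)(ψ)) as functions on Γ^{n+2}, where δⁿ denotes the homogeneous coboundary operator on H-cochains on the left-hand side and on Γ-cochains on the right-hand side. -/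
open MeasureTheory

/-- The homogeneous coboundary operator: it sends a function on `(n)`-tuples to a
function on `(n+1)`-tuples, `(δc)(v₀, …, vₙ) = Σᵢ (-1)ⁱ c(v₀, …, v̂ᵢ, …, vₙ)`. -/
def cobound {A : Type*} {n : ℕ} (c : (Fin n → A) → ℝ) : (Fin (n + 1) → A) → ℝ :=
  fun v => ∑ i : Fin (n + 1), (-1 : ℝ) ^ (i : ℕ) * c (fun j => v (i.succAbove j))

/-- The pullback cochain along a measurable cocycle `σ : Γ × X → H`:
`Cⁿ(σ)(ψ)(γ₀, …, γₙ) = ∫_X ψ(σ(γ₀⁻¹,x)⁻¹, …, σ(γₙ⁻¹,x)⁻¹) dμ(x)`. -/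
noncomputable def pullC {Γ H X : Type*} [Group Γ] [Group H] [MulAction Γ X]
    [MeasurableSpace X] (μ : Measure X) (σ : Γ → X → H)
    {n : ℕ} (ψ : (Fin (n + 1) → H) → ℝ) : (Fin (n + 1) → Γ) → ℝ :=
  fun γs => ∫ x, ψ (fun i => (σ (γs i)⁻¹ x)⁻¹) ∂μ

theorem integrable_pullback_integrand
    {Γ H X : Type*} [Group Γ] [Group H]
    [MeasurableSpace Γ] [MeasurableSpace H] [MeasurableSpace X] [MeasurableInv H]
    {μ : Measure X} [IsFiniteMeasure μ]
    {σ : Γ → X → H} (hσmeas : Measurable fun p : Γ × X => σ p.1 p.2)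
    {ι : Type*} {ψ : (ι → H) → ℝ}
    (hψmeas : Measurable ψ) (hψbdd : ∃ C : ℝ, ∀ v, |ψ v| ≤ C) (γs : ι → Γ) :
    Integrable (fun x => ψ (fun i => (σ (γs i)⁻¹ x)⁻¹)) μ := by
  obtain ⟨C, hC⟩ := hψbdd
  have hmeas : Measurable fun x => ψ (fun i => (σ (γs i)⁻¹ x)⁻¹) :=
    hψmeas.comp (measurable_pi_lambda _ fun i =>
      (hσmeas.comp (measurable_const.prodMk measurable_id)).inv)
  exact Integrable.of_bound hmeas.aestronglyMeasurable C (ae_of_all _ fun x => hC _)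

/-- The pullback along a measurable cocycle is a cochain map:
`C^{n+1}(σ)(δⁿψ) = δⁿ(Cⁿ(σ)(ψ))` as functions on `Γ^{n+2}`. -/
theorem pullback_cochain_map
    {Γ H X : Type*} [Group Γ] [Group H]
    [MeasurableSpace Γ] [MeasurableSpace H] [MeasurableSpace X]
    [MeasurableMul₂ Γ] [MeasurableInv Γ] [MeasurableMul₂ H] [MeasurableInv H]
    [MulAction Γ X]
    (hactmeas : Measurable fun p : Γ × X => p.1 • p.2)
    (μ : Measure X) [IsProbabilityMeasure μ]
    (hμ : ∀ γ : Γ, MeasurePreserving (fun x : X => γ • x) μ μ)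
    (σ : Γ → X → H) (hσmeas : Measurable fun p : Γ × X => σ p.1 p.2)
    (hσ : ∀ γ₁ γ₂ : Γ, ∀ᵐ x ∂μ, σ (γ₁ * γ₂) x = σ γ₁ (γ₂ • x) * σ γ₂ x)
    {n : ℕ} (ψ : (Fin (n + 1) → H) → ℝ)
    (hψmeas : Measurable ψ) (hψbdd : ∃ C : ℝ, ∀ v, |ψ v| ≤ C) :
    ∀ γs : Fin (n + 2) → Γ, pullC μ σ (cobound ψ) γs = cobound (pullC μ σ ψ) γs := by
  intro γs
  simp only [pullC, cobound]
  rw [integral_finsetSum _ fun i _ =>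
    (integrable_pullback_integrand hσmeas hψmeas hψbdd fun j => γs (i.succAbove j)).const_mul _]
  simp only [integral_const_mul]
end

section
/- Let σ: Γ × X → H be a measurable cocycle, f: X → H a measurable map, and σ^f the f-twisted cocycle. Then the maps sⁿ(σ, f) form a chain homotopy between the pullbacks along σ and σ^f on invariant cochains: for every n ≥ 0 and every bounded measurable H-invariant function ψ: H^{n+1} → ℝ one has s^{n+1}(σ, f)(δⁿψ) + δ^{n−1}(sⁿ(σ, f)(ψ)) = Cⁿ(σ)(ψ) − Cⁿ(σ^f)(ψ) as functions on Γ^{n+1}. -/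
open MeasureTheory

/-- The `f`-twisted cocycle `σ^f(γ, x) := f(γ·x)⁻¹ σ(γ, x) f(x)`. -/
def twist {Γ H X : Type*} [Group H] [SMul Γ X] (σ : Γ → X → H) (f : X → H) :
    Γ → X → H :=
  fun γ x => (f (γ • x))⁻¹ * σ γ x * f x

/-- The `(n+1)`-tuple of arguments fed to `ψ` in the homotopy term `sⁿᵢ`: with
`aⱼ = σ(γⱼ⁻¹,x)⁻¹` and `fⱼ = f(γⱼ⁻¹·x)`, the tuple is
`(a₀f₀, …, aᵢfᵢ, aᵢ, a_{i+1}, …, a_{n-1})`. -/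
def sArg {H : Type*} [Group H] {n : ℕ} (i : Fin n) (a fv : Fin n → H) :
    Fin (n + 1) → H :=
  fun k =>
    if h : (k : ℕ) ≤ (i : ℕ) then
      a ⟨(k : ℕ), lt_of_le_of_lt h i.isLt⟩ * fv ⟨(k : ℕ), lt_of_le_of_lt h i.isLt⟩
    else a ⟨(k : ℕ) - 1, by have hk := k.isLt; omega⟩

/-- The homotopy operator `sⁿ(σ, f) := Σ_{i=0}^{n-1} (−1)ⁱ sⁿᵢ(σ, f)`. -/
noncomputable def sMap {Γ H X : Type*} [Group Γ] [Group H] [MulAction Γ X]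
    [MeasurableSpace X] (μ : Measure X) (σ : Γ → X → H) (f : X → H)
    {n : ℕ} (ψ : (Fin (n + 1) → H) → ℝ) : (Fin n → Γ) → ℝ :=
  fun γs => ∑ i : Fin n, (-1 : ℝ) ^ (i : ℕ) *
    ∫ x, ψ (sArg i (fun j => (σ (γs j)⁻¹ x)⁻¹) (fun j => f ((γs j)⁻¹ • x))) ∂μ

section Combinatorics

variable {H : Type*} [Group H] {n : ℕ}

/-- The tuple that agrees with `a * fv` before position `i` and with `a` from `i` on. -/
def mixedTuple (a fv : Fin n → H) (i : ℕ) : Fin n → H :=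
  fun j => if (j : ℕ) < i then a j * fv j else a j

theorem sArg_castSucc_succAbove (i : Fin n) (a fv : Fin n → H) :
    (fun j => sArg i a fv (i.castSucc.succAbove j)) = mixedTuple a fv i := by
  funext j
  by_cases h : (j : ℕ) < i
  · have hj : i.castSucc.succAbove j = j.castSucc :=
      Fin.succAbove_of_castSucc_lt _ _ (Fin.lt_def.2 h)
    simp [hj, sArg, mixedTuple, h, h.le]
  · have hj : i.castSucc.succAbove j = j.succ :=
      Fin.succAbove_of_le_castSucc _ _ (Fin.le_def.2 (not_lt.1 h))
    have h' : ¬ (j : ℕ) + 1 ≤ i := by omega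
    simp [hj, sArg, mixedTuple, h, h']

theorem sArg_succ_succAbove (i : Fin n) (a fv : Fin n → H) :
    (fun j => sArg i a fv (i.succ.succAbove j)) = mixedTuple a fv (i + 1) := by
  funext j
  by_cases h : (j : ℕ) ≤ i
  · have hj : i.succ.succAbove j = j.castSucc :=
      Fin.succAbove_of_castSucc_lt _ _ (by
        simp only [Fin.lt_def, Fin.val_castSucc, Fin.val_succ]; omega)
    have h' : (j : ℕ) < i + 1 := by omega
    simp [hj, sArg, mixedTuple, h, h']
  · have hj : i.succ.succAbove j = j.succ :=
      Fin.succAbove_of_le_castSucc _ _ (by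
        simp only [Fin.le_def, Fin.val_castSucc, Fin.val_succ]; omega)
    have h' : ¬ (j : ℕ) < i + 1 := by omega
    have h'' : ¬ (j : ℕ) + 1 ≤ i := by omega
    simp [hj, sArg, mixedTuple, h', h'']

theorem val_succAbove_eq_ite (p : Fin (n + 1)) (j : Fin n) :
    (p.succAbove j : ℕ) = if (j : ℕ) < p then (j : ℕ) else j + 1 := by
  simp only [Fin.succAbove, Fin.lt_def, Fin.val_castSucc]
  split_ifs <;> rfl

theorem val_predAbove_eq_ite (m : Fin n) (i : Fin (n + 1)) :
    (m.predAbove i : ℕ) = if (m : ℕ) < i then (i : ℕ) - 1 else i := by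
  simp only [Fin.predAbove, Fin.lt_def, Fin.val_castSucc]
  split_ifs <;> rfl

/-- Faces of `sArg` away from the doubled index are `sArg` of faces. -/
theorem sArg_succAbove_succAbove (i : Fin (n + 1)) (m : Fin n) (a fv : Fin (n + 1) → H) :
    (fun j => sArg i a fv ((i.castSucc.succAbove (i.succAbove m)).succAbove j)) =
      sArg (m.predAbove i) (fun j => a ((i.succAbove m).succAbove j))
        (fun j => fv ((i.succAbove m).succAbove j)) := by
  have key : ∀ (p q : Fin (n + 1)), (p : ℕ) = q → a p = a q ∧ fv p = fv q := by
    intro p q h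
    rw [Fin.ext h]
    exact ⟨rfl, rfl⟩
  funext j
  simp only [sArg]
  have hj := j.isLt
  split_ifs with h₁ h₂ h₂
  · have hv : ((i.castSucc.succAbove (i.succAbove m)).succAbove j : ℕ) =
        (i.succAbove m).succAbove ⟨j, h₂.trans_lt (m.predAbove i).isLt⟩ := by
      simp only [val_succAbove_eq_ite, Fin.val_castSucc] at *
      grind
    exact congrArg₂ (· * ·) (key _ _ hv).1 (key _ _ hv).2
  · exfalso
    simp only [val_succAbove_eq_ite, val_predAbove_eq_ite, Fin.val_castSucc] at *
    grind
  · exfalso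
    simp only [val_succAbove_eq_ite, val_predAbove_eq_ite, Fin.val_castSucc] at *
    grind
  · refine (key _ _ ?_).1
    have h₃ := h₁
    have h₄ := h₂
    simp only [val_succAbove_eq_ite, val_predAbove_eq_ite, Fin.val_castSucc] at h₃ h₄ ⊢
    grind

theorem neg_one_pow_succAbove_succAbove (i : Fin (n + 1)) (m : Fin n) :
    (-1 : ℝ) ^ (i : ℕ) * (-1) ^ (i.castSucc.succAbove (i.succAbove m) : ℕ) =
      -((-1) ^ (i.succAbove m : ℕ) * (-1) ^ (m.predAbove i : ℕ)) := by
  by_cases h : m.castSucc < i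
  · have h₁ : i.succAbove m = m.castSucc := Fin.succAbove_of_castSucc_lt _ _ h
    have h₂ : i.castSucc.succAbove m.castSucc = m.castSucc.castSucc :=
      Fin.succAbove_of_castSucc_lt _ _ (by simpa [Fin.lt_def] using h)
    obtain ⟨k, rfl⟩ := Fin.exists_succ_eq.2 (Fin.ne_zero_of_lt h)
    rw [h₁, h₂, Fin.predAbove_of_castSucc_lt _ _ h]
    simp [pow_succ]
    ring
  · have h₁ : i.succAbove m = m.succ := Fin.succAbove_of_le_castSucc _ _ (not_lt.1 h)
    have h₂ : i.castSucc.succAbove m.succ = m.succ.succ :=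
      Fin.succAbove_of_le_castSucc _ _ (by
        simp only [Fin.lt_def, Fin.le_def, Fin.val_castSucc, Fin.val_succ] at *; omega)
    rw [h₁, h₂, Fin.predAbove_of_le_castSucc _ _ (not_lt.1 h)]
    simp [pow_succ]
    ring

theorem sum_succAbove_predAbove (G : Fin (n + 1) → Fin n → ℝ) :
    ∑ i : Fin (n + 1), ∑ m : Fin n, G (i.succAbove m) (m.predAbove i) = ∑ k, ∑ i, G k i := by
  let e : Fin (n + 1) × Fin n → Fin (n + 1) × Fin n :=
    fun p => (p.1.succAbove p.2, p.2.predAbove p.1)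
  have he : Function.Involutive e := by
    rintro ⟨i, m⟩
    refine Prod.ext (Fin.ext ?_) (Fin.ext ?_) <;>
    · simp only [e, val_succAbove_eq_ite, val_predAbove_eq_ite]
      grind
  rw [← Fintype.sum_prod_type', ← Fintype.sum_prod_type']
  exact he.toPerm.sum_comp Finset.univ (fun p => G p.1 p.2) (by simp)

/-- The prism identity for the tuples `sArg`. -/
theorem sum_cobound_sArg_add (ψ : (Fin (n + 1) → H) → ℝ) (a fv : Fin (n + 1) → H) :
    ∑ i : Fin (n + 1), (-1 : ℝ) ^ (i : ℕ) * cobound ψ (sArg i a fv) +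
      ∑ k : Fin (n + 1), (-1 : ℝ) ^ (k : ℕ) * ∑ i : Fin n, (-1 : ℝ) ^ (i : ℕ) *
        ψ (sArg i (fun j => a (k.succAbove j)) (fun j => fv (k.succAbove j))) =
      ψ a - ψ (fun j => a j * fv j) := by
  have hface : ∀ i : Fin (n + 1), (-1 : ℝ) ^ (i : ℕ) * cobound ψ (sArg i a fv) =
      (ψ (mixedTuple a fv i) - ψ (mixedTuple a fv (i + 1))) -
        ∑ m : Fin n, (-1 : ℝ) ^ (i.succAbove m : ℕ) * ((-1) ^ (m.predAbove i : ℕ) *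
          ψ (sArg (m.predAbove i) (fun j => a ((i.succAbove m).succAbove j))
            (fun j => fv ((i.succAbove m).succAbove j)))) := by
    intro i
    have hsq : (-1 : ℝ) ^ (i : ℕ) * (-1) ^ (i : ℕ) = 1 := by
      rw [← mul_pow]; simp
    rw [cobound, Fin.sum_univ_succAbove _ i.castSucc, Fin.sum_univ_succAbove _ i,
      Fin.succAbove_castSucc_self, sArg_castSucc_succAbove, sArg_succ_succAbove,
      mul_add, mul_add, Finset.mul_sum, ← add_assoc, sub_eq_add_neg, ← Finset.sum_neg_distrib]
    congr 1
    · simp only [Fin.val_castSucc, Fin.val_succ, pow_succ]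
      linear_combination (ψ (mixedTuple a fv i) - ψ (mixedTuple a fv (i + 1))) * hsq
    · refine Finset.sum_congr rfl fun m _ => ?_
      rw [sArg_succAbove_succAbove, ← mul_assoc, neg_one_pow_succAbove_succAbove]
      ring
  have htel : ∑ i : Fin (n + 1),
      (ψ (mixedTuple a fv i) - ψ (mixedTuple a fv ((i : ℕ) + 1))) =
        ψ a - ψ (fun j => a j * fv j) := by
    rw [Fin.sum_univ_eq_sum_range
      (fun i => ψ (mixedTuple a fv i) - ψ (mixedTuple a fv (i + 1))), Finset.sum_range_sub']
    have h₀ : mixedTuple a fv 0 = a := by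
      funext j; simp [mixedTuple]
    have h₁ : mixedTuple a fv (n + 1) = fun j => a j * fv j := by
      funext j; simp only [mixedTuple, j.isLt, if_true]
    rw [h₀, h₁]
  simp only [hface, Finset.sum_sub_distrib] at htel ⊢
  rw [htel, sum_succAbove_predAbove (fun k i => (-1 : ℝ) ^ (k : ℕ) * ((-1) ^ (i : ℕ) *
    ψ (sArg i (fun j => a (k.succAbove j)) (fun j => fv (k.succAbove j)))))]
  simp only [Finset.mul_sum, sub_add_cancel]

end Combinatorics

section Measurability

theorem measurable_cobound {A : Type*} [MeasurableSpace A] {n : ℕ} {c : (Fin n → A) → ℝ}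
    (hc : Measurable c) : Measurable (cobound c) :=
  Finset.measurable_fun_sum _ fun _ _ => measurable_const.mul
    (hc.comp (measurable_pi_lambda _ fun _ => measurable_pi_apply _))

theorem abs_cobound_le {A : Type*} {n : ℕ} {c : (Fin n → A) → ℝ} {C : ℝ}
    (hc : ∀ v, |c v| ≤ C) (v : Fin (n + 1) → A) : |cobound c v| ≤ (n + 1) * C := by
  refine (Finset.abs_sum_le_sum_abs _ _).trans ?_
  refine (Finset.sum_le_sum (g := fun _ => C) fun i _ => ?_).trans (by simp)
  simpa [abs_mul] using hc _

theorem measurable_sArg {H X : Type*} [Group H] [MeasurableSpace H] [MeasurableMul₂ H]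
    [MeasurableSpace X] {n : ℕ} (i : Fin n) {a fv : X → Fin n → H}
    (ha : ∀ j, Measurable fun x => a x j) (hf : ∀ j, Measurable fun x => fv x j) :
    Measurable fun x => sArg i (a x) (fv x) := by
  refine measurable_pi_lambda _ fun k => ?_
  simp only [sArg]
  split_ifs with h
  · exact (ha _).mul (hf _)
  · exact ha _

end Measurability

/-- The maps `sⁿ(σ, f)` form a chain homotopy between the pullbacks
along `σ` and along the twisted cocycle `σ^f` on `H`-invariant cochains:
`s^{n+1}(σ,f)(δⁿψ) + δ^{n-1}(sⁿ(σ,f)(ψ)) = Cⁿ(σ)(ψ) − Cⁿ(σ^f)(ψ)` on `Γ^{n+1}`. -/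
theorem homotopy_formula
    {Γ H X : Type*} [Group Γ] [Group H]
    [MeasurableSpace Γ] [MeasurableSpace H] [MeasurableSpace X]
    [MeasurableMul₂ Γ] [MeasurableInv Γ] [MeasurableMul₂ H] [MeasurableInv H]
    [MulAction Γ X]
    (hactmeas : Measurable fun p : Γ × X => p.1 • p.2)
    (μ : Measure X) [IsProbabilityMeasure μ]
    (hμ : ∀ γ : Γ, MeasurePreserving (fun x : X => γ • x) μ μ)
    (σ : Γ → X → H) (hσmeas : Measurable fun p : Γ × X => σ p.1 p.2)
    (hσ : ∀ γ₁ γ₂ : Γ, ∀ᵐ x ∂μ, σ (γ₁ * γ₂) x = σ γ₁ (γ₂ • x) * σ γ₂ x)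
    (f : X → H) (hfmeas : Measurable f)
    {n : ℕ} (ψ : (Fin (n + 1) → H) → ℝ)
    (hψmeas : Measurable ψ) (hψbdd : ∃ C : ℝ, ∀ v, |ψ v| ≤ C)
    (hψinv : ∀ (h : H) (v : Fin (n + 1) → H), ψ (fun i => h * v i) = ψ v) :
    ∀ γs : Fin (n + 1) → Γ,
      sMap μ σ f (cobound ψ) γs + cobound (sMap μ σ f ψ) γs
        = pullC μ σ ψ γs - pullC μ (twist σ f) ψ γs := by
  intro γs
  obtain ⟨C, hC⟩ := hψbdd
  have ha : ∀ γ : Γ, Measurable fun x => (σ γ⁻¹ x)⁻¹ := fun γ =>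
    (hσmeas.comp measurable_prodMk_left).inv
  have hf : ∀ γ : Γ, Measurable fun x => f (γ⁻¹ • x) := fun γ =>
    hfmeas.comp (hactmeas.comp measurable_prodMk_left)
  have hint : ∀ {Y : Type _} [MeasurableSpace Y] {φ : Y → ℝ} {g : X → Y} {B : ℝ},
      Measurable φ → (∀ v, |φ v| ≤ B) → Measurable g → Integrable (fun x => φ (g x)) μ :=
    fun hφ hB hg => Integrable.of_bound (hφ.comp hg).aestronglyMeasurable _
      (Filter.Eventually.of_forall fun x => hB _)
  have hψδ : ∀ i : Fin (n + 1), Integrable (fun x => cobound ψ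
      (sArg i (fun j => (σ (γs j)⁻¹ x)⁻¹) (fun j => f ((γs j)⁻¹ • x)))) μ := fun i =>
    hint (measurable_cobound hψmeas) (abs_cobound_le hC)
      (measurable_sArg i (fun j => ha _) (fun j => hf _))
  have hψs : ∀ (k : Fin (n + 1)) (i : Fin n), Integrable (fun x => ψ
      (sArg i (fun j => (σ (γs (k.succAbove j))⁻¹ x)⁻¹)
        (fun j => f ((γs (k.succAbove j))⁻¹ • x)))) μ := fun k i =>
    hint hψmeas hC (measurable_sArg i (fun j => ha _) (fun j => hf _))
  have htwist : pullC μ (twist σ f) ψ γs =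
      ∫ x, ψ (fun i => (σ (γs i)⁻¹ x)⁻¹ * f ((γs i)⁻¹ • x)) ∂μ := by
    refine integral_congr_ae (Filter.Eventually.of_forall fun x => ?_)
    dsimp only
    rw [← hψinv (f x)⁻¹ (fun i => (σ (γs i)⁻¹ x)⁻¹ * f ((γs i)⁻¹ • x))]
    simp only [twist, mul_inv_rev, inv_inv]
  rw [htwist, pullC, ← integral_sub
    (hint hψmeas hC (measurable_pi_lambda (fun x i => (σ (γs i)⁻¹ x)⁻¹) fun i => ha _))
    (hint hψmeas hC (measurable_pi_lambda (fun x i => (σ (γs i)⁻¹ x)⁻¹ * f ((γs i)⁻¹ • x))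
      fun i => (ha _).mul (hf _)))]
  simp only [← sum_cobound_sArg_add]
  rw [integral_add
      (integrable_finsetSum _ fun i _ => (hψδ i).const_mul _)
      (integrable_finsetSum _ fun k _ => (integrable_finsetSum _ fun i _ =>
        (hψs k i).const_mul _).const_mul _),
    integral_finsetSum _ fun i _ => (hψδ i).const_mul _,
    integral_finsetSum _ fun k _ => (integrable_finsetSum _ fun i _ =>
        (hψs k i).const_mul _).const_mul _]
  simp only [sMap, cobound.eq_def (sMap μ σ f ψ), integral_const_mul]
  congr 1
  refine Finset.sum_congr rfl fun k _ => ?_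
  rw [integral_finsetSum _ fun i _ => (hψs k i).const_mul _]
  simp only [integral_const_mul]
end

section
/- Let σ: Γ × X → H be a measurable cocycle and f: X → H a measurable map. For every n ≥ 1, every 0 ≤ i ≤ n−1 and every bounded measurable H-invariant function ψ: H^{n+1} → ℝ, the function sⁿᵢ(σ, f)(ψ): Γⁿ → ℝ is Γ-invariant: sⁿᵢ(σ, f)(ψ)(γ·γ₀, …, γ·γ_{n−1}) = sⁿᵢ(σ, f)(ψ)(γ₀, …, γ_{n−1}) for all γ, γ₀, …, γ_{n−1} ∈ Γ; consequently sⁿ(σ, f)(ψ) := Σ_{i=0}^{n−1} (−1)ⁱ sⁿᵢ(σ, f)(ψ) is Γ-invariant. -/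
open MeasureTheory

theorem sArg_mul_left {H : Type*} [Group H] {n : ℕ} (i : Fin n) (h : H) (a fv : Fin n → H) :
    sArg i (fun j => h * a j) fv = fun k => h * sArg i a fv k := by
  funext k
  unfold sArg
  split_ifs <;> simp only [mul_assoc]

/-- A measure-preserving group action by measurable maps leaves every integral unchanged; no
measurability of the integrand is needed since each group element acts by a measurable
equivalence. -/
theorem integral_comp_smul_of_measurePreserving {Γ X E : Type*} [Group Γ] [MulAction Γ X]
    [MeasurableSpace X] [NormedAddCommGroup E] [NormedSpace ℝ E] {μ : Measure X}
    (hμ : ∀ γ : Γ, MeasurePreserving (fun x : X => γ • x) μ μ) (γ : Γ) (g : X → E) :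
    ∫ x, g (γ • x) ∂μ = ∫ x, g x ∂μ := by
  let e : X ≃ᵐ X :=
    { MulAction.toPerm γ with
      measurable_toFun := (hμ γ).measurable
      measurable_invFun := (hμ γ⁻¹).measurable }
  exact MeasurePreserving.integral_comp' (f := e) (hμ γ) g

/-- Each homotopy term `sⁿᵢ(σ, f)(ψ) : Γⁿ → ℝ` is `Γ`-invariant, and
consequently so is `sⁿ(σ, f)(ψ) = Σᵢ (−1)ⁱ sⁿᵢ(σ, f)(ψ)`. -/
theorem homotopy_terms_invariant
    {Γ H X : Type*} [Group Γ] [Group H]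
    [MeasurableSpace Γ] [MeasurableSpace H] [MeasurableSpace X]
    [MeasurableMul₂ Γ] [MeasurableInv Γ] [MeasurableMul₂ H] [MeasurableInv H]
    [MulAction Γ X]
    (hactmeas : Measurable fun p : Γ × X => p.1 • p.2)
    (μ : Measure X) [IsProbabilityMeasure μ]
    (hμ : ∀ γ : Γ, MeasurePreserving (fun x : X => γ • x) μ μ)
    (σ : Γ → X → H) (hσmeas : Measurable fun p : Γ × X => σ p.1 p.2)
    (hσ : ∀ γ₁ γ₂ : Γ, ∀ᵐ x ∂μ, σ (γ₁ * γ₂) x = σ γ₁ (γ₂ • x) * σ γ₂ x)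
    (f : X → H) (hfmeas : Measurable f)
    {n : ℕ} (ψ : (Fin (n + 1) → H) → ℝ)
    (hψmeas : Measurable ψ) (hψbdd : ∃ C : ℝ, ∀ v, |ψ v| ≤ C)
    (hψinv : ∀ (h : H) (v : Fin (n + 1) → H), ψ (fun i => h * v i) = ψ v) :
    (∀ (i : Fin n) (γ : Γ) (γs : Fin n → Γ),
        (∫ x, ψ (sArg i (fun j => (σ (γ * γs j)⁻¹ x)⁻¹)
            (fun j => f ((γ * γs j)⁻¹ • x))) ∂μ)
          = ∫ x, ψ (sArg i (fun j => (σ (γs j)⁻¹ x)⁻¹)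
              (fun j => f ((γs j)⁻¹ • x))) ∂μ)
      ∧ ∀ (γ : Γ) (γs : Fin n → Γ),
          sMap μ σ f ψ (fun j => γ * γs j) = sMap μ σ f ψ γs := by
  have term_invariant : ∀ (i : Fin n) (γ : Γ) (γs : Fin n → Γ),
      (∫ x, ψ (sArg i (fun j => (σ (γ * γs j)⁻¹ x)⁻¹)
          (fun j => f ((γ * γs j)⁻¹ • x))) ∂μ)
        = ∫ x, ψ (sArg i (fun j => (σ (γs j)⁻¹ x)⁻¹)
            (fun j => f ((γs j)⁻¹ • x))) ∂μ := by
    intro i γ γs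
    rw [← integral_comp_smul_of_measurePreserving hμ γ⁻¹
      (fun x => ψ (sArg i (fun j => (σ (γs j)⁻¹ x)⁻¹) (fun j => f ((γs j)⁻¹ • x))))]
    refine integral_congr_ae ?_
    filter_upwards [ae_all_iff.2 fun j => hσ (γs j)⁻¹ γ⁻¹] with x hx
    simp only [mul_inv_rev, hx, mul_smul, sArg_mul_left, hψinv]
  refine ⟨term_invariant, fun γ γs => ?_⟩
  simp only [sMap, term_invariant]
end

section
/- Let σ: Γ × X → H be a measurable cocycle, f: X → H a measurable map, and σ^f the f-twisted cocycle. If ψ: H^{n+1} → ℝ is a bounded measurable H-invariant function with δⁿψ = 0, then there exists a bounded Γ-invariant function b: Γⁿ → ℝ such that Cⁿ(σ)(ψ) − Cⁿ(σ^f)(ψ) = δ^{n−1}b; hence the pullbacks of the cohomology class of ψ along σ and along σ^f coincide. -/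
open MeasureTheory

lemma cobound_cons {A : Type*} {n : ℕ} (c : (Fin (n + 1) → A) → ℝ) (a : A) (v : Fin (n + 1) → A) :
    cobound c (Fin.cons a v : Fin (n + 2) → A) = c v - cobound (fun w => c (Fin.cons a w)) v := by
  have hsucc (i : Fin (n + 1)) :
      (fun j => (Fin.cons a v : Fin (n + 2) → A) (i.succ.succAbove j))
        = Fin.cons a (fun j => v (i.succAbove j)) := by
    funext j
    refine Fin.cases ?_ (fun j => ?_) j
    · simp
    · simp [Fin.succ_succAbove_succ]
  unfold cobound
  rw [Fin.sum_univ_succ, sub_eq_add_neg, ← Finset.sum_neg_distrib]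
  congr 1
  · simp
  · refine Finset.sum_congr rfl fun i _ => ?_
    rw [hsucc, Fin.val_succ]
    ring

lemma cobound_sub {A : Type*} {n : ℕ} (c d : (Fin n → A) → ℝ) (v : Fin (n + 1) → A) :
    cobound (fun w => c w - d w) v = cobound c v - cobound d v := by
  simp only [cobound, mul_sub, Finset.sum_sub_distrib]

lemma cobound_comp {A B : Type*} {n : ℕ} (g : A → B) (c : (Fin n → B) → ℝ) (v : Fin (n + 1) → A) :
    cobound (fun w => c (g ∘ w)) v = cobound c (g ∘ v) := rfl

/-- The prism operator: it sends `ψ` to the alternating sum of the values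
`ψ (u₀, …, uₖ, vₖ, …, vₙ₋₁)`, where `z = (u, v)`. -/
def prism {A : Type*} : {n : ℕ} → ((Fin (n + 1) → A) → ℝ) → (Fin n → A × A) → ℝ
  | 0, _, _ => 0
  | _ + 1, ψ, z => ψ (Fin.cons (z 0).1 (Prod.snd ∘ z))
      - prism (fun w => ψ (Fin.cons (z 0).1 w)) (Fin.tail z)

lemma prism_sub {A : Type*} {n : ℕ} (ψ φ : (Fin (n + 1) → A) → ℝ) (z : Fin n → A × A) :
    prism (fun w => ψ w - φ w) z = prism ψ z - prism φ z := by
  induction n with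
  | zero => simp [prism]
  | succ n ih =>
    simp only [prism, ih]
    ring

lemma prism_zero {A : Type*} {n : ℕ} (z : Fin n → A × A) :
    prism (fun _ : Fin (n + 1) → A => (0 : ℝ)) z = 0 := by
  simpa using prism_sub (fun _ => (0 : ℝ)) (fun _ => 0) z

lemma prism_comp {A B : Type*} {n : ℕ} (g : A → B) (ψ : (Fin (n + 1) → B) → ℝ)
    (z : Fin n → A × A) :
    prism ψ (Prod.map g g ∘ z) = prism (fun w => ψ (g ∘ w)) z := by
  induction n with
  | zero => rfl
  | succ n ih =>
    simp only [prism, Fin.comp_cons]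
    congr 1
    exact ih _ (Fin.tail z)

lemma abs_prism_le {A : Type*} {n : ℕ} {ψ : (Fin (n + 1) → A) → ℝ} {C : ℝ}
    (hψ : ∀ v, |ψ v| ≤ C) (z : Fin n → A × A) : |prism ψ z| ≤ n * C := by
  induction n with
  | zero => simp [prism]
  | succ n ih =>
    rw [prism]
    refine (abs_sub _ _).trans ?_
    have h := ih (fun w => hψ (Fin.cons (z 0).1 w)) (Fin.tail z)
    push_cast
    linarith [hψ (Fin.cons (z 0).1 (Prod.snd ∘ z))]

lemma measurable_finCons {A Y : Type*} [MeasurableSpace A] [MeasurableSpace Y] {n : ℕ}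
    {a : Y → A} {v : Y → Fin n → A} (ha : Measurable a) (hv : Measurable v) :
    Measurable fun y => (Fin.cons (a y) (v y) : Fin (n + 1) → A) := by
  refine measurable_pi_lambda _ fun i => Fin.cases ?_ (fun i => ?_) i
  · simpa using ha
  · simpa [Function.comp_def] using (measurable_pi_apply i).comp hv

lemma measurable_prism {A Y : Type*} [MeasurableSpace A] [MeasurableSpace Y] {n : ℕ}
    {ψ : Y → (Fin (n + 1) → A) → ℝ} (hψ : Measurable (Function.uncurry ψ))
    {z : Y → Fin n → A × A} (hz : Measurable z) :
    Measurable fun y => prism (ψ y) (z y) := by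
  induction n generalizing Y with
  | zero => exact measurable_const
  | succ n ih =>
    simp only [prism]
    have hcoord (i : Fin (n + 1)) : Measurable fun y => z y i := (measurable_pi_apply i).comp hz
    refine Measurable.sub ?_ (ih ?_ ?_)
    · exact hψ.comp (measurable_id.prodMk (measurable_finCons (hcoord 0).fst
        (measurable_pi_lambda _ fun i => (hcoord i).snd)))
    · exact hψ.comp (measurable_fst.prodMk (measurable_finCons
        ((hcoord 0).fst.comp measurable_fst) measurable_snd))
    · exact measurable_pi_lambda _ fun i => hcoord i.succ

/-- The prism operator is a cochain homotopy between the two coordinate projections. -/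
lemma cobound_prism_add_prism_cobound {A : Type*} {n : ℕ} (ψ : (Fin (n + 1) → A) → ℝ)
    (z : Fin (n + 1) → A × A) :
    cobound (prism ψ) z + prism (cobound ψ) z = ψ (Prod.snd ∘ z) - ψ (Prod.fst ∘ z) := by
  induction n with
  | zero =>
    have hv : (fun j => (Fin.cons (z 0).1 (Prod.snd ∘ z) : Fin 2 → A) (Fin.succAbove 1 j))
        = Prod.fst ∘ z := by
      funext j
      simp [Subsingleton.elim j 0]
    have hz : (fun j => (z j).2) = Prod.snd ∘ z := rfl
    simp [prism, cobound, hv, hz, sub_eq_add_neg]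
  | succ n ih =>
    obtain ⟨p, y, rfl⟩ : ∃ p y, z = Fin.cons p y := ⟨z 0, Fin.tail z, (Fin.cons_self_tail z).symm⟩
    obtain ⟨a, b⟩ := p
    have hP : (fun w => prism ψ (Fin.cons (a, b) w : Fin (n + 1) → A × A))
        = fun w => (fun w' : Fin n → A => ψ (Fin.cons a (Fin.cons b w'))) (Prod.snd ∘ w)
          - prism (fun w' => ψ (Fin.cons a w')) w := by
      funext w
      simp [prism, Fin.comp_cons]
    have hQ : (fun w => cobound ψ (Fin.cons a w : Fin (n + 3) → A))
        = fun w => ψ w - cobound (fun w' => ψ (Fin.cons a w')) w := by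
      funext w
      exact cobound_cons ψ a w
    have hc := cobound_comp Prod.snd (fun w' : Fin n → A => ψ (Fin.cons a (Fin.cons b w'))) y
    have := ih (fun w => ψ (Fin.cons a w)) y
    have hPQ : prism (cobound ψ) (Fin.cons (a, b) y : Fin (n + 2) → A × A)
        = cobound ψ (Fin.cons a (Fin.cons b (Prod.snd ∘ y)))
          - prism (fun w => cobound ψ (Fin.cons a w : Fin (n + 3) → A)) y := by
      rw [prism, Fin.comp_cons]
      rfl
    rw [cobound_cons, hP, cobound_sub, hc, hPQ, hQ, prism_sub, cobound_cons, cobound_cons,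
      Fin.comp_cons, Fin.comp_cons]
    linarith

lemma integral_cobound {A B X : Type*} [MeasurableSpace X] {μ : Measure X} {n : ℕ}
    (c : (Fin n → B) → ℝ) (z : X → A → B)
    (hc : ∀ v : Fin n → A, Integrable (fun x => c (z x ∘ v)) μ) (v : Fin (n + 1) → A) :
    cobound (fun w => ∫ x, c (z x ∘ w) ∂μ) v = ∫ x, cobound c (z x ∘ v) ∂μ := by
  unfold cobound
  refine Eq.trans ?_ (integral_finsetSum _ fun i _ =>
    (hc fun j => v (i.succAbove j)).const_mul _).symm
  simp only [integral_const_mul]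
  rfl

/-- If `ψ` is a bounded measurable `H`-invariant cocycle (`δⁿψ = 0`),
then `Cⁿ(σ)(ψ) − Cⁿ(σ^f)(ψ)` is the coboundary `δ^{n-1}b` of a bounded `Γ`-invariant
function `b : Γⁿ → ℝ`; hence the pullbacks of the class of `ψ` along `σ` and along
`σ^f` coincide. -/
theorem pullback_cohomologous_cocycles
    {Γ H X : Type*} [Group Γ] [Group H]
    [MeasurableSpace Γ] [MeasurableSpace H] [MeasurableSpace X]
    [MeasurableMul₂ Γ] [MeasurableInv Γ] [MeasurableMul₂ H] [MeasurableInv H]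
    [MulAction Γ X]
    (hactmeas : Measurable fun p : Γ × X => p.1 • p.2)
    (μ : Measure X) [IsProbabilityMeasure μ]
    (hμ : ∀ γ : Γ, MeasurePreserving (fun x : X => γ • x) μ μ)
    (σ : Γ → X → H) (hσmeas : Measurable fun p : Γ × X => σ p.1 p.2)
    (hσ : ∀ γ₁ γ₂ : Γ, ∀ᵐ x ∂μ, σ (γ₁ * γ₂) x = σ γ₁ (γ₂ • x) * σ γ₂ x)
    (f : X → H) (hfmeas : Measurable f)
    {n : ℕ} (ψ : (Fin (n + 1) → H) → ℝ)
    (hψmeas : Measurable ψ) (hψbdd : ∃ C : ℝ, ∀ v, |ψ v| ≤ C)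
    (hψinv : ∀ (h : H) (v : Fin (n + 1) → H), ψ (fun i => h * v i) = ψ v)
    (hψcocycle : ∀ v : Fin (n + 2) → H, cobound ψ v = 0) :
    ∃ b : (Fin n → Γ) → ℝ,
      (∃ C : ℝ, ∀ v, |b v| ≤ C) ∧
      (∀ (γ : Γ) (γs : Fin n → Γ), b (fun j => γ * γs j) = b γs) ∧
      ∀ γs : Fin (n + 1) → Γ,
        pullC μ σ ψ γs - pullC μ (twist σ f) ψ γs = cobound b γs := by
  obtain ⟨C, hC⟩ := hψbdd
  have hσγ (γ : Γ) : Measurable (σ γ) := hσmeas.comp measurable_prodMk_left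
  let s : X → Γ → H := fun x γ => (σ γ⁻¹ x)⁻¹
  let z : X → Γ → H × H := fun x γ => (s x γ * f (γ⁻¹ • x), s x γ)
  have hs (γ : Γ) : Measurable fun x => s x γ := (hσγ _).inv
  have hz (γ : Γ) : Measurable fun x => z x γ :=
    ((hs γ).mul (hfmeas.comp (hμ _).measurable)).prodMk (hs γ)
  have hzpi {m : ℕ} (v : Fin m → Γ) : Measurable fun x => z x ∘ v :=
    measurable_pi_lambda _ fun i => hz (v i)
  have hPmeas (v : Fin n → Γ) : Measurable fun x => prism ψ (z x ∘ v) :=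
    measurable_prism (ψ := fun _ : X => ψ) (hψmeas.comp measurable_snd) (hzpi v)
  have hPint (v : Fin n → Γ) : Integrable (fun x => prism ψ (z x ∘ v)) μ :=
    .of_bound (hPmeas v).aestronglyMeasurable (n * C) (.of_forall fun _ => abs_prism_le hC _)
  have hψint (g : H × H → H) (hg : Measurable g) (v : Fin (n + 1) → Γ) :
      Integrable (fun x => ψ (g ∘ z x ∘ v)) μ :=
    .of_bound (hψmeas.comp (measurable_pi_lambda _ fun i =>
      hg.comp (hz (v i)))).aestronglyMeasurable C (.of_forall fun _ => hC _)
  refine ⟨fun v => ∫ x, prism ψ (z x ∘ v) ∂μ, ⟨n * C, fun v => ?_⟩, fun γ v => ?_, fun v => ?_⟩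
  · have hbound : ∀ᵐ x ∂μ, ‖prism ψ (z x ∘ v)‖ ≤ n * C :=
      .of_forall fun x => abs_prism_le hC (z x ∘ v)
    simpa using norm_integral_le_of_norm_le_const hbound
  · have hshift : (fun x => prism ψ (z x ∘ fun j => γ * v j))
        =ᵐ[μ] fun x => prism ψ (z (γ⁻¹ • x) ∘ v) := by
      have hae : ∀ᵐ x ∂μ, ∀ j, σ ((v j)⁻¹ * γ⁻¹) x = σ (v j)⁻¹ (γ⁻¹ • x) * σ γ⁻¹ x :=
        ae_all_iff.2 fun j => hσ _ _
      filter_upwards [hae] with x hx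
      have hzx : (z x ∘ fun j => γ * v j)
          = Prod.map ((σ γ⁻¹ x)⁻¹ * ·) ((σ γ⁻¹ x)⁻¹ * ·) ∘ (z (γ⁻¹ • x) ∘ v) := by
        funext j
        simp [z, s, hx, mul_assoc, mul_smul]
      rw [hzx, prism_comp]
      congr 1
      exact funext fun w => hψinv _ w
    calc ∫ x, prism ψ (z x ∘ fun j => γ * v j) ∂μ
        = ∫ x, prism ψ (z (γ⁻¹ • x) ∘ v) ∂μ := integral_congr_ae hshift
      _ = ∫ x, prism ψ (z x ∘ v) ∂(μ.map (γ⁻¹ • ·)) :=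
        (integral_map (hμ γ⁻¹).aemeasurable (hPmeas v).aestronglyMeasurable).symm
      _ = ∫ x, prism ψ (z x ∘ v) ∂μ := by rw [(hμ γ⁻¹).map_eq]
  · have htwist (x : X) : ψ (fun i => (twist σ f (v i)⁻¹ x)⁻¹) = ψ (Prod.fst ∘ z x ∘ v) := by
      rw [← hψinv (f x)⁻¹ (Prod.fst ∘ z x ∘ v)]
      simp [twist, z, s, Function.comp_def, mul_assoc]
    have hhom (x : X) : cobound (prism ψ) (z x ∘ v)
        = ψ (Prod.snd ∘ z x ∘ v) - ψ (Prod.fst ∘ z x ∘ v) := by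
      rw [← cobound_prism_add_prism_cobound, funext hψcocycle, prism_zero, add_zero]
    rw [integral_cobound (prism ψ) z hPint v]
    simp only [pullC, htwist, hhom]
    rw [integral_sub (hψint _ measurable_snd v) (hψint _ measurable_fst v)]
    rfl
end

section
/- Let σ: Γ × X → H be a measurable cocycle with a boundary map φ: B × X → Y, and let ψ: Y^{n+1} → ℝ be a bounded measurable H-invariant function. Then the implemented pullback Cⁿ(Φ^X)(ψ)(ξ₀, …, ξₙ) := ∫_X ψ(φ(ξ₀, x), …, φ(ξₙ, x)) dμ(x) is Γ-invariant: for every γ ∈ Γ, for ν^{⊗(n+1)}-almost every (ξ₀, …, ξₙ) ∈ B^{n+1} one has ∫_X ψ(φ(γ·ξ₀, x), …, φ(γ·ξₙ, x)) dμ(x) = ∫_X ψ(φ(ξ₀, x), …, φ(ξₙ, x)) dμ(x). -/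
open MeasureTheory

/-- The implemented pullback
`Cⁿ(Φ^X)(ψ)(ξ₀, …, ξₙ) = ∫_X ψ(φ(ξ₀,x), …, φ(ξₙ,x)) dμ(x)` along a boundary map `φ`
of a measurable cocycle `σ` is `Γ`-invariant almost everywhere. -/
theorem implemented_pullback_invariant
    {Γ H X B Y : Type*} [Group Γ] [Group H]
    [MeasurableSpace Γ] [MeasurableSpace H] [MeasurableSpace X]
    [MeasurableSpace B] [MeasurableSpace Y]
    [MeasurableMul₂ Γ] [MeasurableInv Γ] [MeasurableMul₂ H] [MeasurableInv H]
    [MulAction Γ X] [MulAction Γ B] [MulAction H Y]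
    (hactmeas : Measurable fun p : Γ × X => p.1 • p.2)
    (hBmeas : ∀ γ : Γ, Measurable fun ξ : B => γ • ξ)
    (hYmeas : Measurable fun p : H × Y => p.1 • p.2)
    (μ : Measure X) [IsProbabilityMeasure μ]
    (hμ : ∀ γ : Γ, MeasurePreserving (fun x : X => γ • x) μ μ)
    (ν : Measure B) [SigmaFinite ν]
    (hqi : ∀ γ : Γ, Measure.map (fun ξ : B => γ • ξ) ν ≪ ν
      ∧ ν ≪ Measure.map (fun ξ : B => γ • ξ) ν)
    (σ : Γ → X → H) (hσmeas : Measurable fun p : Γ × X => σ p.1 p.2)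
    (hσ : ∀ γ₁ γ₂ : Γ, ∀ᵐ x ∂μ, σ (γ₁ * γ₂) x = σ γ₁ (γ₂ • x) * σ γ₂ x)
    (φ : B → X → Y) (hφmeas : Measurable fun p : B × X => φ p.1 p.2)
    (hφ : ∀ γ : Γ, ∀ᵐ p : B × X ∂ν.prod μ,
      φ (γ • p.1) (γ • p.2) = σ γ p.2 • φ p.1 p.2)
    {n : ℕ} (ψ : (Fin (n + 1) → Y) → ℝ)
    (hψmeas : Measurable ψ) (hψbdd : ∃ C : ℝ, ∀ v, |ψ v| ≤ C)
    (hψinv : ∀ (h : H) (v : Fin (n + 1) → Y), ψ (fun i => h • v i) = ψ v) :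
    ∀ γ : Γ, ∀ᵐ ξs ∂(Measure.pi fun _ : Fin (n + 1) => ν),
      (∫ x, ψ (fun i => φ (γ • ξs i) x) ∂μ)
        = ∫ x, ψ (fun i => φ (ξs i) x) ∂μ := by
  intro γ
  have hξ : ∀ᵐ ξ ∂ν, ∀ᵐ x ∂μ, φ (γ • ξ) (γ • x) = σ γ x • φ ξ x :=
    Measure.ae_ae_of_ae_prod (hφ γ)
  have hξs : ∀ᵐ ξs ∂(Measure.pi fun _ : Fin (n + 1) => ν), ∀ i, ∀ᵐ x ∂μ,
      φ (γ • ξs i) (γ • x) = σ γ x • φ (ξs i) x :=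
    ae_all_iff.2 fun i => 
      (Measure.tendsto_eval_ae_ae (μ := fun _ : Fin (n + 1) => ν) (i := i)).eventually hξ
  filter_upwards [hξs] with ξs h
  have hmeas : Measurable fun x => ψ fun i => φ (γ • ξs i) x :=
    hψmeas.comp (measurable_pi_lambda _ fun _ => hφmeas.comp measurable_prodMk_left)
  calc
    ∫ x, ψ (fun i => φ (γ • ξs i) x) ∂μ
        = ∫ x, ψ (fun i => φ (γ • ξs i) (γ • x)) ∂μ := by
      conv_lhs => rw [← (hμ γ).map_eq]
      exact integral_map (hμ γ).aemeasurable hmeas.aestronglyMeasurable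
    _ = ∫ x, ψ (fun i => φ (ξs i) x) ∂μ := by
      refine integral_congr_ae ?_
      filter_upwards [ae_all_iff.2 h] with x hx
      simp only [hx, hψinv]
end

section
/- Let σ: Γ × X → H be a measurable cocycle with a boundary map φ: B × X → Y. Let π: Γ → H be a group homomorphism and V: B → Y a map satisfying V(γ·ξ) = π(γ)·V(ξ) for all γ ∈ Γ and all ξ ∈ B. Suppose f: X → H is a measurable map such that φ(ξ, x) = f(x)·V(ξ) for (ν ⊗ μ)-almost every (ξ, x), and suppose that the H-action separates points along V, in the sense that the only h ∈ H with h·V(ξ) = V(ξ) for ν-almost every ξ ∈ B is h = 1. Then for every γ ∈ Γ and μ-almost every x ∈ X one has f(γ·x)⁻¹ σ(γ, x) f(x) = π(γ); that is, σ is cohomologous to the measurable cocycle (γ, x) ↦ π(γ) associated to the representation π. -/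
open MeasureTheory

/-- Let `φ` be a boundary map for a measurable cocycle `σ`, let
`π : Γ → H` be a homomorphism and `V : B → Y` a `π`-equivariant map.  If
`φ(ξ, x) = f(x)·V(ξ)` almost everywhere for a measurable `f : X → H` and the
`H`-action separates points along `V`, then `f(γ·x)⁻¹ σ(γ,x) f(x) = π(γ)` for a.e. `x`:
the cocycle `σ` is cohomologous to the cocycle associated to the representation `π`. -/
theorem maximal_cocycle_trivialization
    {Γ H X B Y : Type*} [Group Γ] [Group H]
    [MeasurableSpace Γ] [MeasurableSpace H] [MeasurableSpace X]
    [MeasurableSpace B] [MeasurableSpace Y]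
    [MeasurableMul₂ Γ] [MeasurableInv Γ] [MeasurableMul₂ H] [MeasurableInv H]
    [MulAction Γ X] [MulAction Γ B] [MulAction H Y]
    (hactmeas : Measurable fun p : Γ × X => p.1 • p.2)
    (hBmeas : ∀ γ : Γ, Measurable fun ξ : B => γ • ξ)
    (hYmeas : Measurable fun p : H × Y => p.1 • p.2)
    (μ : Measure X) [IsProbabilityMeasure μ]
    (hμ : ∀ γ : Γ, MeasurePreserving (fun x : X => γ • x) μ μ)
    (ν : Measure B) [SigmaFinite ν]
    (hqi : ∀ γ : Γ, Measure.map (fun ξ : B => γ • ξ) ν ≪ ν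
      ∧ ν ≪ Measure.map (fun ξ : B => γ • ξ) ν)
    (σ : Γ → X → H) (hσmeas : Measurable fun p : Γ × X => σ p.1 p.2)
    (hσ : ∀ γ₁ γ₂ : Γ, ∀ᵐ x ∂μ, σ (γ₁ * γ₂) x = σ γ₁ (γ₂ • x) * σ γ₂ x)
    (φ : B → X → Y) (hφmeas : Measurable fun p : B × X => φ p.1 p.2)
    (hφ : ∀ γ : Γ, ∀ᵐ p : B × X ∂ν.prod μ,
      φ (γ • p.1) (γ • p.2) = σ γ p.2 • φ p.1 p.2)
    (π : Γ →* H) (V : B → Y)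
    (hV : ∀ (γ : Γ) (ξ : B), V (γ • ξ) = π γ • V ξ)
    (f : X → H) (hfmeas : Measurable f)
    (hfV : ∀ᵐ p : B × X ∂ν.prod μ, φ p.1 p.2 = f p.2 • V p.1)
    (hsep : ∀ h : H, (∀ᵐ ξ ∂ν, h • V ξ = V ξ) → h = 1) :
    ∀ γ : Γ, ∀ᵐ x ∂μ, (f (γ • x))⁻¹ * σ γ x * f x = π γ := by
  intro γ
  have hγ : Measure.QuasiMeasurePreserving (fun ξ : B => γ • ξ) ν ν := ⟨hBmeas γ, (hqi γ).1⟩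
  have hprod : Measure.QuasiMeasurePreserving
      (Prod.map (fun ξ : B => γ • ξ) (fun x : X => γ • x)) (ν.prod μ) (ν.prod μ) :=
    MeasureTheory.QuasiMeasurePreserving.prodMap hγ (hμ γ).quasiMeasurePreserving
  have key : ∀ᵐ p : B × X ∂ν.prod μ,
      ((π γ)⁻¹ * ((f (γ • p.2))⁻¹ * σ γ p.2 * f p.2)) • V p.1 = V p.1 := by
    filter_upwards [hφ γ, hfV, hprod.ae hfV] with p h₁ h₂ h₃
    simp only [Prod.map_fst, Prod.map_snd] at h₃
    rw [h₃, h₂, hV] at h₁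
    rw [mul_smul, mul_smul, mul_smul, ← h₁, inv_smul_smul, inv_smul_smul]
  have hswap : ∀ᵐ q : X × B ∂μ.prod ν,
      ((π γ)⁻¹ * ((f (γ • q.1))⁻¹ * σ γ q.1 * f q.1)) • V q.2 = V q.2 :=
    Measure.measurePreserving_swap.quasiMeasurePreserving.ae key
  filter_upwards [Measure.ae_ae_of_ae_prod hswap] with x hx
  exact (inv_mul_eq_one.mp (hsep _ hx)).symm
end
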